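/- arXiv:2004.09306 — 3 statements merged into one kernel-verified Lean document; each statement's English description precedes it below -/
import Mathlib

section
/- For a directed acyclic graph D on vertices {1,…,p} with all edges directed from larger to smaller vertices, a multivariate Gaussian N_p(0, Ω⁻¹) obeys the directed Markov property with respect to D if and only if the unit lower triangular factor L in the modified Cholesky decomposition Ω = L D⁻¹ Lᵀ satisfies L_ij = 0 whenever i is not a parent of j in D. -/
open Matrix Real MeasureTheory ProbabilityTheory

/-- The conditional law of `Z + m(Y)` given `Y`, for `Z` independent of `Y`. -/
lemma condDistrib_add_of_indep {α β : Type*} [MeasurableSpace α] [MeasurableSpace β]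
    (μ : Measure α) [IsProbabilityMeasure μ] (Z X : α → ℝ) (Y : α → β)
    (hZ : Measurable Z) (hY : Measurable Y) (h : IndepFun Y Z μ)
    (m : β → ℝ) (hm : Measurable m) (hX : ∀ x, X x = Z x + m (Y x)) :
    ∃ κ : Kernel β ℝ, (∀ y, κ y = (μ.map Z).map (fun z => z + m y)) ∧
      condDistrib X Y μ =ᵐ[μ.map Y] κ := by
  have hXm : Measurable X := by
    have : X = fun x => Z x + m (Y x) := funext hX
    rw [this]; fun_prop
  have : IsProbabilityMeasure (μ.map Z) := Measure.isProbabilityMeasure_map hZ.aemeasurable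
  have : IsProbabilityMeasure (μ.map Y) := Measure.isProbabilityMeasure_map hY.aemeasurable
  have hf : Measurable (fun q : β × ℝ => q.2 + m q.1) := by fun_prop
  let κ : Kernel β ℝ :=
    (Kernel.id ×ₖ Kernel.const β (μ.map Z)).map (fun q : β × ℝ => q.2 + m q.1)
  have hκ : ∀ y, κ y = (μ.map Z).map (fun z => z + m y) := by
    intro y
    simp only [κ]
    rw [Kernel.map_apply _ hf, Kernel.prod_apply, Kernel.id_apply, Kernel.const_apply,
      Measure.dirac_prod, Measure.map_map hf (by fun_prop)]
    rfl
  refine ⟨κ, hκ, ?_⟩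
  have : IsMarkovKernel κ := Kernel.IsMarkovKernel.map _ hf
  refine condDistrib_ae_eq_of_measure_eq_compProd Y hXm.aemeasurable ?_
  have hg : Measurable (fun q : β × ℝ => (q.1, q.2 + m q.1)) := by fun_prop
  have e1 : μ.map (fun x => (Y x, X x))
      = ((μ.map Y).prod (μ.map Z)).map (fun q : β × ℝ => (q.1, q.2 + m q.1)) := by
    rw [← (indepFun_iff_map_prod_eq_prod_map_map hY.aemeasurable hZ.aemeasurable).1 h,
      Measure.map_map hg (by fun_prop)]
    congr 1
    funext x
    simp [hX]
  rw [e1]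
  ext s hs
  rw [Measure.map_apply hg hs, Measure.prod_apply (hg hs), Measure.compProd_apply hs]
  refine lintegral_congr fun y => ?_
  rw [hκ, Measure.map_apply (by fun_prop) (measurable_prodMk_left hs)]
  rfl

/-- Product of one dimensional Gaussians as a density. -/
lemma pi_gaussianReal_eq {p : ℕ} (v : Fin p → NNReal) (hv : ∀ i, v i ≠ 0) :
    Measure.pi (fun i => gaussianReal 0 (v i)) =
      (volume : Measure (Fin p → ℝ)).withDensity
        (fun z => ENNReal.ofReal (∏ i, gaussianPDFReal 0 (v i) (z i))) := by
  refine Measure.pi_eq fun s hs => ?_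
  rw [withDensity_apply _ (MeasurableSet.univ_pi hs), volume_pi, Measure.restrict_pi_pi,
    ← ofReal_integral_eq_lintegral_ofReal, integral_fintype_prod_eq_prod,
    ENNReal.ofReal_prod_of_nonneg]
  · refine Finset.prod_congr rfl fun i _ => ?_
    rw [gaussianReal_apply_eq_integral _ (hv i)]
  · intro i _
    exact integral_nonneg fun x => gaussianPDFReal_nonneg _ _ _
  · exact Integrable.fintype_prod fun i => (integrable_gaussianPDFReal _ _).restrict
  · exact Filter.Eventually.of_forall fun x =>
      Finset.prod_nonneg fun i _ => gaussianPDFReal_nonneg _ _ _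

/-- A conull set for Lebesgue measure cannot force a nontrivial linear relation in direction `k`. -/
lemma no_ae_relation {p : ℕ} (k : Fin p) (P : (Fin p → ℝ) → Prop)
    (hP : ∀ᵐ x ∂(volume : Measure (Fin p → ℝ)), P x)
    (hne : ∀ x, P x → ¬ P (x + Pi.single k 1)) : False := by
  have h2 := (measurePreserving_add_right (volume : Measure (Fin p → ℝ))
    (Pi.single k 1)).quasiMeasurePreserving.ae hP
  obtain ⟨x, hx, hx'⟩ := (hP.and h2).exists
  exact hne x hx hx'

lemma density_eq {p : ℕ} (Ω L D : Matrix (Fin p) (Fin p) ℝ)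
    (hdetL : L.det = 1)
    (hDdiag : D.IsDiag) (hDpos : ∀ i, 0 < D i i)
    (hdecomp : Ω = L * D⁻¹ * L.transpose) (v : Fin p → NNReal) (hv : ∀ i, (v i : ℝ) = D i i)
    (x : Fin p → ℝ) :
    (2 * π) ^ (-(p : ℝ) / 2) * Ω.det ^ ((1 : ℝ) / 2)
        * Real.exp (-(1 / 2) * (x ⬝ᵥ (Ω *ᵥ x))) =
      ∏ i, gaussianPDFReal 0 (v i) ((Lᵀ *ᵥ x) i) := by
  have hDinv : D⁻¹ = diagonal (fun i => (D i i)⁻¹) := by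
    apply Matrix.inv_eq_right_inv
    conv_lhs => rw [← hDdiag.diagonal_diag]
    rw [diagonal_mul_diagonal, ← diagonal_one]
    congr 1
    funext i
    simp [(hDpos i).ne']
  have hdet : Ω.det = ∏ i, (D i i)⁻¹ := by
    rw [hdecomp, det_mul, det_mul, det_transpose, hdetL, hDinv, det_diagonal]; simp
  have hq : x ⬝ᵥ (Ω *ᵥ x) = ∑ i, (D i i)⁻¹ * ((Lᵀ *ᵥ x) i) ^ 2 := by
    rw [hdecomp, ← mulVec_mulVec, ← mulVec_mulVec, dotProduct_mulVec, hDinv,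
      ← mulVec_transpose, dotProduct]
    refine Finset.sum_congr rfl fun i _ => ?_
    rw [mulVec_diagonal]; ring
  simp only [gaussianPDFReal, Finset.prod_mul_distrib, ← Real.exp_sum, hq, hdet, hv]
  congr 1
  · rw [← Real.finsetProd_rpow _ _ (fun i _ => (inv_pos.2 (hDpos i)).le)]
    have : (2 * π) ^ (-(p : ℝ) / 2) = ∏ _i : Fin p, (2 * π) ^ (-(1/2) : ℝ) := by
      rw [Finset.prod_const, Finset.card_univ, Fintype.card_fin, ← Real.rpow_natCast,
        ← Real.rpow_mul (by positivity)]
      congr 1; ring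
    rw [this, ← Finset.prod_mul_distrib]
    refine Finset.prod_congr rfl fun i _ => ?_
    have := hDpos i
    rw [Real.sqrt_eq_rpow, Real.mul_rpow (by positivity) this.le, mul_inv,
      Real.rpow_neg (by positivity), Real.inv_rpow this.le]
  · congr 1
    rw [Finset.mul_sum]
    refine Finset.sum_congr rfl fun i _ => ?_
    have := (hDpos i).ne'
    field_simp
    ring

lemma map_eq_pi {p : ℕ} (Ω L D : Matrix (Fin p) (Fin p) ℝ)
    (hdetL : L.det = 1)
    (hDdiag : D.IsDiag) (hDpos : ∀ i, 0 < D i i)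
    (hdecomp : Ω = L * D⁻¹ * L.transpose) (v : Fin p → NNReal) (hv : ∀ i, (v i : ℝ) = D i i)
    (μ : Measure (Fin p → ℝ))
    (hμ : μ = MeasureTheory.volume.withDensity fun x =>
      ENNReal.ofReal ((2 * π) ^ (-(p : ℝ) / 2) * Ω.det ^ ((1 : ℝ) / 2)
        * Real.exp (-(1 / 2) * (x ⬝ᵥ (Ω *ᵥ x))))) :
    μ.map (fun x => Lᵀ *ᵥ x) = Measure.pi (fun i => gaussianReal 0 (v i)) := by
  have hv0 : ∀ i, v i ≠ 0 := fun i h => by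
    have := hDpos i
    rw [← hv i, h] at this
    simp at this
  have hT : Measurable (fun x : Fin p → ℝ => Lᵀ *ᵥ x) :=
    (Continuous.matrix_mulVec continuous_const continuous_id).measurable
  have hmp : MeasurePreserving (fun x : Fin p → ℝ => Lᵀ *ᵥ x) volume volume := by
    refine ⟨hT, ?_⟩
    have := Real.map_matrix_volume_pi_eq_smul_volume_pi (M := Lᵀ) (by simp [hdetL])
    rw [det_transpose, hdetL] at this
    have e : (fun x : Fin p → ℝ => Lᵀ *ᵥ x) = ⇑(toLin' Lᵀ) := by
      funext x
      rw [toLin'_apply]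
    rw [e, this]
    simp
  have hF : Measurable (fun z : Fin p → ℝ =>
      ENNReal.ofReal (∏ i, gaussianPDFReal 0 (v i) (z i))) := by
    refine ENNReal.measurable_ofReal.comp (Finset.measurable_prod _ fun i _ => ?_)
    exact (measurable_gaussianPDFReal _ _).comp (measurable_pi_apply i)
  rw [pi_gaussianReal_eq v hv0]
  ext s hs
  rw [Measure.map_apply hT hs, hμ, withDensity_apply _ (hT hs), withDensity_apply _ hs,
    ← hmp.setLIntegral_comp_preimage hs hF]
  refine lintegral_congr fun x => ?_
  rw [density_eq Ω L D hdetL hDdiag hDpos hdecomp v hv]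

lemma indep_aux {p : ℕ} (L : Matrix (Fin p) (Fin p) ℝ)
    (hLlow : ∀ i j : Fin p, i < j → L i j = 0) (hdetL : L.det = 1)
    (v : Fin p → NNReal)
    (μ : Measure (Fin p → ℝ)) [IsProbabilityMeasure μ]
    (hmap : μ.map (fun x => Lᵀ *ᵥ x) = Measure.pi (fun i => gaussianReal 0 (v i)))
    (j : Fin p) :
    IndepFun (fun (x : Fin p → ℝ) (a : Finset.Ioi j) => x a.1) (fun x => (Lᵀ *ᵥ x) j) μ ∧
      μ.map (fun x => (Lᵀ *ᵥ x) j) = gaussianReal 0 (v j) := by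
  have hT : Measurable (fun x : Fin p → ℝ => Lᵀ *ᵥ x) :=
    (Continuous.matrix_mulVec continuous_const continuous_id).measurable
  have hTi : ∀ i, Measurable (fun x : Fin p → ℝ => (Lᵀ *ᵥ x) i) := fun i =>
    (measurable_pi_apply i).comp hT
  have hmarg : ∀ i, μ.map (fun x => (Lᵀ *ᵥ x) i) = gaussianReal 0 (v i) := by
    intro i
    have := (measurePreserving_eval (fun i => gaussianReal 0 (v i)) i).map_eq
    rw [← hmap, Measure.map_map (measurable_pi_apply i) hT] at this
    exact this
  refine ⟨?_, hmarg j⟩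
  have hind : iIndepFun (fun i (x : Fin p → ℝ) => (Lᵀ *ᵥ x) i) μ := by
    rw [iIndepFun_iff_map_fun_eq_pi_map (fun i => (hTi i).aemeasurable)]
    simp_rw [hmarg]
    exact hmap
  have h1 := hind.indepFun_finset (Finset.Ioi j) {j} (by simp) hTi
  have hbt : BlockTriangular Lᵀ id := fun a b hab => hLlow b a hab
  have hdu : IsUnit Lᵀ.det := by simp [hdetL]
  have : Invertible Lᵀ := Matrix.invertibleOfIsUnitDet _ hdu
  have hbti := blockTriangular_inv_of_blockTriangular hbt
  have hinv : ∀ x : Fin p → ℝ, x = (Lᵀ)⁻¹ *ᵥ (Lᵀ *ᵥ x) := by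
    intro x
    rw [mulVec_mulVec, Matrix.nonsing_inv_mul _ hdu, one_mulVec]
  let φ : (Finset.Ioi j → ℝ) → (Finset.Ioi j → ℝ) := fun u a => ∑ k, (Lᵀ)⁻¹ a.1 k.1 * u k
  have hφ : Measurable φ := by
    refine measurable_pi_lambda _ fun a => ?_
    exact Finset.measurable_sum _ fun k _ => (measurable_pi_apply k).const_mul _
  let ψ : (({j} : Finset (Fin p)) → ℝ) → ℝ := fun u => u ⟨j, by simp⟩
  have hψ : Measurable ψ := measurable_pi_apply _
  have h2 := h1.comp hφ hψ
  have e1 : (φ ∘ fun (x : Fin p → ℝ) (i : Finset.Ioi j) => (Lᵀ *ᵥ x) i.1)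
      = fun (x : Fin p → ℝ) (a : Finset.Ioi j) => x a.1 := by
    funext x a
    conv_rhs => rw [hinv x]
    simp only [φ, Function.comp]
    rw [Finset.sum_coe_sort (Finset.Ioi j) (fun k => (Lᵀ)⁻¹ a.1 k * (Lᵀ *ᵥ x) k)]
    conv_rhs => rw [mulVec, dotProduct]
    refine Finset.sum_subset (Finset.subset_univ _) fun k _ hk => ?_
    have hka : k < a.1 := by
      have := Finset.mem_Ioi.1 a.2
      simp only [Finset.mem_Ioi, not_lt] at hk
      exact hk.trans_lt this
    rw [show (Lᵀ)⁻¹ a.1 k = 0 from hbti hka, zero_mul]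
  rw [e1] at h2
  exact h2

lemma markov_at_iff {p : ℕ}
    (pa : Finset (Fin p)) (j : Fin p) (hpa : ∀ i ∈ pa, j < i)
    (L : Matrix (Fin p) (Fin p) ℝ)
    (hLlow : ∀ i j : Fin p, i < j → L i j = 0)
    (hLdiag : ∀ i, L i i = 1)
    (v : NNReal)
    (μ : Measure (Fin p → ℝ)) [IsProbabilityMeasure μ]
    (hac : (volume : Measure (Fin p → ℝ)) ≪ μ)
    (hind : IndepFun (fun (x : Fin p → ℝ) (a : Finset.Ioi j) => x a.1)
      (fun x => (Lᵀ *ᵥ x) j) μ)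
    (hlaw : μ.map (fun x => (Lᵀ *ᵥ x) j) = gaussianReal 0 v) :
    CondIndepFun
          (MeasurableSpace.comap (fun (x : Fin p → ℝ) (a : {i // i ∈ pa}) => x a.1)
            inferInstance)
          ((measurable_pi_lambda _ fun _ =>
            measurable_pi_apply _ : Measurable
              (fun (x : Fin p → ℝ) (a : {i // i ∈ pa}) => x a.1)).comap_le)
          (fun x : Fin p → ℝ => x j)
          (fun (x : Fin p → ℝ) (a : {i : Fin p // j < i ∧ i ∉ pa}) => x a.1) μ
      ↔ (∀ i, j < i → i ∉ pa → L i j = 0) := by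
  set W : (Fin p → ℝ) → ({i // i ∈ pa} → ℝ) := fun x a => x a.1 with hW
  set V : (Fin p → ℝ) → ({i : Fin p // j < i ∧ i ∉ pa} → ℝ) := fun x a => x a.1 with hV
  set Z : (Fin p → ℝ) → ℝ := fun x => (Lᵀ *ᵥ x) j with hZ
  have mW : Measurable W := measurable_pi_lambda _ fun _ => measurable_pi_apply _
  have mV : Measurable V := measurable_pi_lambda _ fun _ => measurable_pi_apply _
  have mZ : Measurable Z := (measurable_pi_apply j).comp
    (Continuous.matrix_mulVec continuous_const continuous_id).measurable
  let h : ({i // i ∈ pa} → ℝ) → ℝ := fun w => -∑ a, L a.1 j * w a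
  let c : ({i : Fin p // j < i ∧ i ∉ pa} → ℝ) → ℝ := fun u => -∑ a, L a.1 j * u a
  have mh : Measurable h :=
    (Finset.measurable_sum _ fun k _ => (measurable_pi_apply k).const_mul _).neg
  have mc : Measurable c :=
    (Finset.measurable_sum _ fun k _ => (measurable_pi_apply k).const_mul _).neg
  have hX : ∀ x : Fin p → ℝ, x j = Z x + (h (W x) + c (V x)) := by
    intro x
    have e0 : Z x = ∑ i, L i j * x i := rfl
    have e1 : h (W x) = -∑ i ∈ pa, L i j * x i := by
      simp only [h, W]
      rw [Finset.sum_coe_sort pa (fun i => L i j * x i)]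
    have e2 : c (V x) = -∑ i with (j < i ∧ i ∉ pa), L i j * x i := by
      simp only [c, V]
      rw [← Finset.sum_subtype_eq_sum_filter, Finset.subtype_univ]
    have e3 : ∑ i, L i j * x i = x j + ∑ i ∈ pa, L i j * x i
        + ∑ i with (j < i ∧ i ∉ pa), L i j * x i := by
      have hj : x j = ∑ i, if i = j then L i j * x i else 0 := by
        simp [hLdiag]
      have hp : ∑ i ∈ pa, L i j * x i = ∑ i, if i ∈ pa then L i j * x i else 0 := by
        simp
      rw [hp, Finset.sum_filter]
      conv_rhs => rw [hj]
      rw [← Finset.sum_add_distrib, ← Finset.sum_add_distrib]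
      refine Finset.sum_congr rfl fun i _ => ?_
      rcases lt_trichotomy i j with hij | hij | hij
      · simp [hLlow i j hij]
      · subst hij
        have : i ∉ pa := fun hi => lt_irrefl _ (hpa i hi)
        simp [this]
      · by_cases hi : i ∈ pa <;> simp [hi, hij, hij.ne']
    rw [e0, e1, e2, e3]; ring
  -- independence
  let φ : (Finset.Ioi j → ℝ) → ({i // i ∈ pa} → ℝ) × ({i : Fin p // j < i ∧ i ∉ pa} → ℝ) :=
    fun u => (fun a => u ⟨a.1, Finset.mem_Ioi.2 (hpa a.1 a.2)⟩,
      fun a => u ⟨a.1, Finset.mem_Ioi.2 a.2.1⟩)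
  have mφ : Measurable φ := by
    refine Measurable.prodMk ?_ ?_ <;>
      exact measurable_pi_lambda _ fun _ => measurable_pi_apply _
  have hindWV : IndepFun (fun x => (W x, V x)) Z μ := hind.comp mφ measurable_id
  obtain ⟨κ, hκ, hcd⟩ := condDistrib_add_of_indep μ Z (fun x => x j) (fun x => (W x, V x)) mZ
    (mW.prodMk mV) hindWV (fun q => h q.1 + c q.2) (by fun_prop) hX
  have hκ' : ∀ q, κ q = gaussianReal (h q.1 + c q.2) v := by
    intro q
    rw [hκ, hlaw, gaussianReal_map_add_const, zero_add]
  have key : CondIndepFun _ mW.comap_le (fun x : Fin p → ℝ => x j) V μ ↔ _ :=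
    ⟨CondIndepFun.symm, CondIndepFun.symm⟩
  rw [key, condIndepFun_iff_condDistrib_prod_ae_eq_prodMkRight (measurable_pi_apply j) mV mW]
  constructor
  · intro hci k hjk hkpa
    by_contra hLk
    have h1 : ∀ᵐ q ∂μ.map (fun x => (W x, V x)),
        gaussianReal (h q.1 + c q.2) v = condDistrib (fun x => x j) W μ q.1 := by
      filter_upwards [hci, hcd] with q h1 h2
      rw [← hκ', ← h2, h1, Kernel.prodMkRight_apply]
    have h2 := hac.ae_le (ae_of_ae_map (mW.prodMk mV).aemeasurable h1)
    refine no_ae_relation k _ h2 ?_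
    intro x hx hx'
    have eW : W (x + Pi.single k 1) = W x := by
      funext a
      have : a.1 ≠ k := fun e => hkpa (e ▸ a.2)
      simp [W, this]
    have eV : c (V (x + Pi.single k 1)) = c (V x) - L k j := by
      have : ∀ a : {i : Fin p // j < i ∧ i ∉ pa}, L a.1 j * V (x + Pi.single k 1) a
          = L a.1 j * V x a + if a = ⟨k, hjk, hkpa⟩ then L k j else 0 := by
        intro a
        by_cases ha : a = ⟨k, hjk, hkpa⟩
        · subst ha; simp [V, mul_add]
        · have : a.1 ≠ k := fun e => ha (Subtype.ext e)
          simp [V, this, ha]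
      simp only [c]
      rw [Finset.sum_congr rfl fun a _ => this a, Finset.sum_add_distrib]
      simp; ring
    simp only [eW, eV] at hx'
    have h3 := hx.trans hx'.symm
    have h4 := congrArg (fun ν : Measure ℝ => ∫ y, y ∂ν) h3
    simp only [integral_id_gaussianReal] at h4
    apply hLk
    linarith
  · intro hL0
    have hc0 : ∀ u, c u = 0 := by
      intro u
      simp only [c]
      rw [Finset.sum_eq_zero, neg_zero]
      intro a _
      rw [hL0 a.1 a.2.1 a.2.2, zero_mul]
    have hindW : IndepFun W Z μ := hindWV.comp measurable_fst measurable_id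
    obtain ⟨η, hη, hcd'⟩ := condDistrib_add_of_indep μ Z (fun x => x j) W mZ
      mW hindW h mh (by intro x; rw [hX x, hc0, add_zero])
    have e : μ.map W = (μ.map (fun x => (W x, V x))).map Prod.fst := by
      rw [Measure.map_map measurable_fst (mW.prodMk mV)]; rfl
    rw [e] at hcd'
    have h1 := ae_of_ae_map measurable_fst.aemeasurable hcd'
    filter_upwards [hcd, h1] with q h2 h3
    rw [h2, Kernel.prodMkRight_apply, h3, hκ, hη, hc0, add_zero]

theorem gaussian_directed_markov_iff_cholesky_sparsity {p : ℕ}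
    (pa : Fin p → Finset (Fin p)) (hpa : ∀ j : Fin p, ∀ i ∈ pa j, j < i)
    (Ω L D : Matrix (Fin p) (Fin p) ℝ)
    (hΩ : Ω.PosDef) (hsymm : Ω.IsSymm)
    (hLlow : ∀ i j : Fin p, i < j → L i j = 0)
    (hLdiag : ∀ i, L i i = 1)
    (hDdiag : D.IsDiag) (hDpos : ∀ i, 0 < D i i)
    (hdecomp : Ω = L * D⁻¹ * L.transpose)
    (μ : Measure (Fin p → ℝ)) [IsProbabilityMeasure μ]
    (hμ : μ = MeasureTheory.volume.withDensity fun x =>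
      ENNReal.ofReal ((2 * π) ^ (-(p : ℝ) / 2) * Ω.det ^ ((1 : ℝ) / 2)
        * Real.exp (-(1 / 2) * (x ⬝ᵥ (Ω *ᵥ x))))) :
    (∀ j : Fin p,
        CondIndepFun
          (MeasurableSpace.comap (fun (x : Fin p → ℝ) (a : {i // i ∈ pa j}) => x a.1)
            inferInstance)
          ((measurable_pi_lambda _ fun _ =>
            measurable_pi_apply _ : Measurable
              (fun (x : Fin p → ℝ) (a : {i // i ∈ pa j}) => x a.1)).comap_le)
          (fun x : Fin p → ℝ => x j)
          (fun (x : Fin p → ℝ) (a : {i : Fin p // j < i ∧ i ∉ pa j}) => x a.1) μ)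
      ↔ (∀ i j : Fin p, i ≠ j → i ∉ pa j → L i j = 0) := by
  have hdetL : L.det = 1 := by
    rw [det_of_lowerTriangular L (fun a b hab => hLlow a b hab)]
    simp [hLdiag]
  let v : Fin p → NNReal := fun i => ⟨D i i, (hDpos i).le⟩
  have hmap := map_eq_pi Ω L D hdetL hDdiag hDpos hdecomp v (fun _ => rfl) μ hμ
  have hac : (volume : Measure (Fin p → ℝ)) ≪ μ := by
    rw [hμ]
    refine withDensity_absolutelyContinuous' ?_ ?_
    · refine Measurable.aemeasurable (ENNReal.measurable_ofReal.comp ?_)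
      have : Continuous (fun x : Fin p → ℝ => x ⬝ᵥ (Ω *ᵥ x)) :=
        Continuous.dotProduct continuous_id
          (Continuous.matrix_mulVec continuous_const continuous_id)
      fun_prop
    · refine Filter.Eventually.of_forall fun x => ?_
      have := hΩ.det_pos
      have : 0 < (2 * π) ^ (-(p : ℝ) / 2) * Ω.det ^ ((1 : ℝ) / 2)
        * Real.exp (-(1 / 2) * (x ⬝ᵥ (Ω *ᵥ x))) := by positivity
      exact (ENNReal.ofReal_pos.2 this).ne'
  have hj : ∀ j, _ := fun j => markov_at_iff (pa j) j (hpa j) L hLlow hLdiag (v j) μ hac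
    (indep_aux L hLlow hdetL v μ hmap j).1 (indep_aux L hLlow hdetL v μ hmap j).2
  constructor
  · intro H i j hij hi
    rcases lt_or_gt_of_ne hij with h | h
    · exact hLlow i j h
    · exact (hj j).1 (H j) i h hi
  · intro H j
    exact (hj j).2 fun i hji hi => H i j hji.ne' hi
end

section
/- For a DAG D with edges from larger to smaller vertices, the set of Gaussian distributions obeying the directed Markov property with respect to D equals {N_p(0, (Lᵀ)⁻¹ D L⁻¹) : (D,L) ∈ Θ_D}, where Θ_D is the Cholesky space of D. -/
open Matrix Real MeasureTheory ProbabilityTheory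

lemma pi_gaussian_density (p : ℕ) :
    Measure.pi (fun _ : Fin p => gaussianReal 0 1) =
      (volume : Measure (Fin p → ℝ)).withDensity
        (fun x => ENNReal.ofReal (∏ i, gaussianPDFReal 0 1 (x i))) := by
  refine Measure.pi_eq fun s hs => ?_
  rw [withDensity_apply _ (MeasurableSet.univ_pi hs)]
  have hint : ∀ i : Fin p, Integrable (gaussianPDFReal 0 1) (volume.restrict (s i)) :=
    fun i => (integrable_gaussianPDFReal 0 1).restrict
  rw [volume_pi, Measure.restrict_pi_pi]
  rw [← ofReal_integral_eq_lintegral_ofReal]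
  · rw [integral_fintype_prod_eq_prod, ENNReal.ofReal_prod_of_nonneg]
    · refine Finset.prod_congr rfl fun i _ => ?_
      rw [gaussianReal_apply_eq_integral _ (by simp)]
    · intro i _
      exact integral_nonneg fun x => gaussianPDFReal_nonneg _ _ _
  · exact Integrable.fintype_prod hint
  · exact Filter.Eventually.of_forall fun x =>
      Finset.prod_nonneg fun i _ => gaussianPDFReal_nonneg _ _ _

lemma map_gaussian_density {p : ℕ} (Ω B : Matrix (Fin p) (Fin p) ℝ) (hB : Bᵀ * B = Ω)
    (hdet : B.det ≠ 0) (c : ℝ) (μ : Measure (Fin p → ℝ)) [IsProbabilityMeasure μ]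
    (hμ : μ = volume.withDensity fun x =>
      ENNReal.ofReal (c * Real.exp (-(1 / 2) * (x ⬝ᵥ (Ω *ᵥ x))))) :
    μ.map (toLin' B) = Measure.pi (fun _ : Fin p => gaussianReal 0 1) := by
  have hmB : Measurable (toLin' B) := (toLin' B).continuous_of_finiteDimensional.measurable
  obtain ⟨k, hk⟩ : ∃ k : ENNReal, μ.map (toLin' B) =
      k • Measure.pi (fun _ : Fin p => gaussianReal 0 1) := by
    rw [pi_gaussian_density]
    let g : (Fin p → ℝ) → ENNReal := fun y => ENNReal.ofReal (∏ i, gaussianPDFReal 0 1 (y i))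
    have hg : Measurable g := by
      refine ENNReal.measurable_ofReal.comp ?_
      exact Finset.measurable_prod _ fun i _ =>
        (measurable_gaussianPDFReal 0 1).comp (measurable_pi_apply i)
    obtain ⟨k₁, hk₁⟩ : ∃ k₁ : ENNReal, (fun x : Fin p → ℝ =>
      ENNReal.ofReal (c * Real.exp (-(1 / 2) * (x ⬝ᵥ (Ω *ᵥ x))))) =
        fun x => k₁ * g (toLin' B x) := by
      have hs : (0:ℝ) < (√(2 * π))⁻¹ := by positivity
      refine ⟨ENNReal.ofReal (c * (((√(2 * π))⁻¹) ^ p)⁻¹), ?_⟩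
      funext x
      simp only [g]
      rw [← ENNReal.ofReal_mul' (Finset.prod_nonneg fun i _ => gaussianPDFReal_nonneg _ _ _)]
      congr 1
      have e1 : x ⬝ᵥ (Ω *ᵥ x) = ∑ i, (toLin' B x i) ^ 2 := by
        rw [← hB, ← mulVec_mulVec, dotProduct_mulVec, vecMul_transpose]
        simp [dotProduct, sq]
      rw [e1]
      simp only [gaussianPDFReal]
      rw [Finset.prod_mul_distrib, ← Real.exp_sum]
      simp only [NNReal.coe_one, mul_one, sub_zero, Finset.prod_const, Finset.card_univ,
        Fintype.card_fin]
      have e2 : -(1 / 2) * ∑ i, (toLin' B x i) ^ 2 = ∑ i, -(toLin' B x i) ^ 2 / 2 := by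
        rw [Finset.mul_sum]; exact Finset.sum_congr rfl fun i _ => by ring
      rw [e2]
      have : ((√(2 * π))⁻¹) ^ p ≠ 0 := (pow_pos hs p).ne'
      rw [mul_assoc, inv_mul_cancel_left₀ this]
    refine ⟨k₁ * ENNReal.ofReal (abs (B.det)⁻¹), ?_⟩
    ext s hs
    rw [Measure.map_apply hmB hs, hμ, hk₁, withDensity_apply _ (hmB hs), Measure.smul_apply,
      withDensity_apply _ hs, lintegral_const_mul k₁ (f := fun x => g (toLin' B x)) (hg.comp hmB)]
    have h1 := setLIntegral_map (μ := volume) hs hg hmB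
    rw [Real.map_matrix_volume_pi_eq_smul_volume_pi hdet, Measure.restrict_smul,
      lintegral_smul_measure] at h1
    rw [← h1]
    simp only [smul_eq_mul, mul_assoc, g]
  have : IsProbabilityMeasure (μ.map (toLin' B)) := Measure.isProbabilityMeasure_map hmB.aemeasurable
  have h1 : μ.map (toLin' B) Set.univ = 1 := measure_univ
  rw [hk, Measure.smul_apply, measure_univ, smul_eq_mul, mul_one] at h1
  rw [hk, h1, one_smul]

lemma gaussian_facts {p : ℕ} (Sig : Matrix (Fin p) (Fin p) ℝ) (hSig : Sig.PosDef)
    (c : ℝ) (μ : Measure (Fin p → ℝ)) [IsProbabilityMeasure μ]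
    (hμ : μ = volume.withDensity fun x =>
      ENNReal.ofReal (c * Real.exp (-(1 / 2) * (x ⬝ᵥ (Sig⁻¹ *ᵥ x))))) :
    HasGaussianLaw (fun x : Fin p → ℝ => x) μ ∧
      ∀ i k, cov[fun x : Fin p → ℝ => x i, fun x => x k; μ] = Sig i k := by
  obtain ⟨B, hB⟩ : ∃ B : Matrix (Fin p) (Fin p) ℝ, Bᵀ * B = Sig⁻¹ := by
    open scoped MatrixOrder in
    obtain ⟨B, hB⟩ := CStarAlgebra.nonneg_iff_eq_star_mul_self.mp hSig.inv.posSemidef.nonneg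
    exact ⟨B, by rw [hB, star_eq_conjTranspose, conjTranspose_eq_transpose_of_trivial]⟩
  have hdet : B.det ≠ 0 := by
    intro h
    have := hSig.inv.det_pos
    rw [← hB, det_mul, h, mul_zero] at this
    exact lt_irrefl _ this
  have hmap := map_gaussian_density _ B hB hdet c μ hμ
  have hu : IsUnit B.det := isUnit_iff_ne_zero.mpr hdet
  have hCC : B⁻¹ * (B⁻¹)ᵀ = Sig := by
    rw [transpose_nonsing_inv, ← Matrix.mul_inv_rev, hB, Matrix.nonsing_inv_nonsing_inv]
    exact (isUnit_iff_ne_zero.mpr hSig.det_pos.ne')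
  have hmB : Measurable (toLin' B) := (toLin' B).continuous_of_finiteDimensional.measurable
  have hYlaw : ∀ i, μ.map (fun x => toLin' B x i) = gaussianReal 0 1 := by
    intro i
    have := Measure.map_map (μ := μ) (measurable_pi_apply i) hmB
    rw [hmap] at this
    rw [(measurePreserving_eval (fun _ : Fin p => gaussianReal 0 1) i).map_eq] at this
    exact this.symm
  have hYm : ∀ i, Measurable (fun x => toLin' B x i) := fun i => (measurable_pi_apply i).comp hmB
  have hYind : iIndepFun (fun i x => toLin' B x i) μ := by
    rw [iIndepFun_iff_map_fun_eq_pi_map (fun i => (hYm i).aemeasurable)]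
    simp_rw [hYlaw]
    exact hmap
  have hYg : ∀ i, HasGaussianLaw (fun x => toLin' B x i) μ := fun i =>
    ⟨by rw [hYlaw]; infer_instance⟩
  have hY := iIndepFun.hasGaussianLaw hYg hYind
  have hx : ∀ x : Fin p → ℝ, x = toLin' B⁻¹ (toLin' B x) := by
    intro x
    simp [mulVec_mulVec, nonsing_inv_mul _ hu]
  have hG : HasGaussianLaw (fun x : Fin p → ℝ => x) μ := by
    have := hY.map_fun (LinearMap.toContinuousLinearMap (toLin' B⁻¹))
    refine this.congr (Filter.Eventually.of_forall fun x => ?_)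
    exact (hx x).symm
  refine ⟨hG, fun i k => ?_⟩
  have hx' : ∀ i, (fun x : Fin p → ℝ => x i) = fun x => ∑ a, B⁻¹ i a * toLin' B x a := by
    intro i; funext x
    conv_lhs => rw [hx x]
    simp [mulVec, dotProduct]
  have hcov : ∀ a b, cov[fun x => toLin' B x a, fun x => toLin' B x b; μ] =
      if a = b then 1 else 0 := by
    intro a b
    split_ifs with h
    · subst h
      rw [covariance_self (hYm a).aemeasurable]
      have := variance_id_gaussianReal (μ := 0) (v := 1)
      rw [← hYlaw a, variance_map aemeasurable_id (hYm a).aemeasurable] at this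
      simpa using this
    · exact (hYind.indepFun h).covariance_eq_zero (hYg a).memLp_two (hYg b).memLp_two
  rw [hx' i, hx' k, covariance_fun_sum_fun_sum (fun a => (hYg a).memLp_two.const_mul _)
    (fun a => (hYg a).memLp_two.const_mul _)]
  simp_rw [covariance_const_mul_left, covariance_const_mul_right, hcov]
  rw [← hCC]
  simp [Matrix.mul_apply]

lemma map_add_indep {Ω S : Type*} {mΩ : MeasurableSpace Ω} {mS : MeasurableSpace S}
    (μ : Measure Ω) [IsProbabilityMeasure μ] (W : Ω → S) (hW : Measurable W)
    (E : Ω → ℝ) (hE : Measurable E) (f : S → ℝ) (hf : Measurable f) (κ : Kernel S ℝ)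
    [IsMarkovKernel κ] (hκ : ∀ w, κ w = (μ.map E).map (fun e => f w + e)) :
    μ.map (fun x => (W x, f (W x) + E x)) = μ.map W ⊗ₘ κ ↔ IndepFun E W μ := by
  have : IsProbabilityMeasure (μ.map W) := Measure.isProbabilityMeasure_map hW.aemeasurable
  have : IsProbabilityMeasure (μ.map E) := Measure.isProbabilityMeasure_map hE.aemeasurable
  let T : S × ℝ → S × ℝ := fun q => (q.1, f q.1 + q.2)
  let T' : S × ℝ → S × ℝ := fun q => (q.1, q.2 - f q.1)
  have hT : Measurable T := by fun_prop
  have hT' : Measurable T' := by fun_prop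
  have hT'T : T' ∘ T = id := by funext q; simp [T, T']
  have e1 : μ.map (fun x => (W x, f (W x) + E x)) = (μ.map (fun x => (W x, E x))).map T := by
    rw [Measure.map_map hT (hW.prodMk hE)]; rfl
  have e2 : μ.map W ⊗ₘ κ = ((μ.map W).prod (μ.map E)).map T := by
    ext s hs
    rw [Measure.compProd_apply hs, Measure.map_apply hT hs, Measure.prod_apply (hT hs)]
    refine lintegral_congr fun w => ?_
    rw [hκ, Measure.map_apply (by fun_prop) (measurable_prodMk_left hs)]
    rfl
  have hc : IndepFun E W μ ↔ IndepFun W E μ := ⟨fun h => h.symm, fun h => h.symm⟩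
  rw [e1, e2, hc, indepFun_iff_map_prod_eq_prod_map_map hW.aemeasurable hE.aemeasurable]
  constructor
  · intro h
    have := congrArg (Measure.map T') h
    rwa [Measure.map_map hT' hT, Measure.map_map hT' hT, hT'T, Measure.map_id, Measure.map_id]
      at this
  · intro h; rw [h]

lemma condIndep_iff_indep {Ω S R : Type*} {mΩ : MeasurableSpace Ω} [StandardBorelSpace Ω]
    {mS : MeasurableSpace S} {mR : MeasurableSpace R} [StandardBorelSpace R] [Nonempty R]
    (μ : Measure Ω) [IsProbabilityMeasure μ] (Y : Ω → S) (hY : Measurable Y)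
    (Z : Ω → R) (hZ : Measurable Z) (X : Ω → ℝ) (hX : Measurable X)
    (E : Ω → ℝ) (hE : Measurable E) (f : S → ℝ) (hf : Measurable f)
    (hXE : ∀ x, X x = f (Y x) + E x) (hEY : IndepFun E Y μ) :
    CondIndepFun (MeasurableSpace.comap Y mS) hY.comap_le X Z μ ↔
      IndepFun E (fun x => (Y x, Z x)) μ := by
  have : IsProbabilityMeasure (μ.map E) := Measure.isProbabilityMeasure_map hE.aemeasurable
  let κ : Kernel S ℝ := (Kernel.prodMkLeft S (Kernel.const Unit (μ.map E))).comap
    (fun w : S => (w, ())) (by fun_prop) |> fun k => (Kernel.id ×ₖ k).map (fun q => f q.1 + q.2)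
  have hκ : ∀ w, κ w = (μ.map E).map (fun e => f w + e) := by
    intro w
    simp only [κ]
    rw [Kernel.map_apply _ (by fun_prop), Kernel.prod_apply, Kernel.id_apply, Kernel.comap_apply,
      Kernel.prodMkLeft_apply, Kernel.const_apply, Measure.dirac_prod,
      Measure.map_map (by fun_prop) (by fun_prop)]
    rfl
  have hM : IsMarkovKernel κ := ⟨fun w => by
    rw [hκ]; exact Measure.isProbabilityMeasure_map (by fun_prop)⟩
  have hXf : X = fun x => f (Y x) + E x := funext hXE
  have h1 : condDistrib X Y μ =ᵐ[μ.map Y] κ := by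
    rw [condDistrib_ae_eq_iff_measure_eq_compProd _ hX.aemeasurable, hXf]
    exact (map_add_indep μ Y hY E hE f hf κ hκ).2 hEY
  have h2 := map_add_indep μ (fun x => (Y x, Z x)) (hY.prodMk hZ) E hE (fun q => f q.1)
    (by fun_prop) (κ.prodMkRight R) (fun w => by rw [Kernel.prodMkRight_apply, hκ])
  have hsym : CondIndepFun (MeasurableSpace.comap Y mS) hY.comap_le X Z μ ↔
    CondIndepFun (MeasurableSpace.comap Y mS) hY.comap_le Z X μ := ⟨fun h => h.symm, fun h => h.symm⟩
  rw [hsym, condIndepFun_iff_condDistrib_prod_ae_eq_prodMkRight hX hZ hY, ← h2]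
  have h3 : (condDistrib X Y μ).prodMkRight R =ᵐ[μ.map (fun x => (Y x, Z x))] κ.prodMkRight R := by
    have hq : Measure.QuasiMeasurePreserving Prod.fst (μ.map (fun x => (Y x, Z x))) (μ.map Y) := by
      refine ⟨measurable_fst, ?_⟩
      rw [Measure.map_map measurable_fst (hY.prodMk hZ)]
      exact Measure.AbsolutelyContinuous.refl _
    filter_upwards [hq.ae h1] with q hq
    rw [Kernel.prodMkRight_apply, Kernel.prodMkRight_apply, hq]
  have h4 := condDistrib_ae_eq_iff_measure_eq_compProd (μ := μ) (fun x => (Y x, Z x))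
    hX.aemeasurable (κ.prodMkRight R)
  rw [hXf] at *
  rw [← h4]
  exact ⟨fun h => h.trans h3, fun h => h.trans h3.symm⟩

lemma cov_lin {p : ℕ} (Sig : Matrix (Fin p) (Fin p) ℝ) (μ : Measure (Fin p → ℝ))
    [IsProbabilityMeasure μ] (hG : HasGaussianLaw (fun x : Fin p → ℝ => x) μ)
    (hcov : ∀ i k, cov[fun x : Fin p → ℝ => x i, fun x => x k; μ] = Sig i k)
    (u : Fin p → ℝ) (k : Fin p) :
    cov[fun x : Fin p → ℝ => ∑ i, u i * x i, fun x => x k; μ] = ∑ i, u i * Sig i k := by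
  have hL : ∀ i, MemLp (fun x : Fin p → ℝ => x i) 2 μ := fun i =>
    (HasGaussianLaw.eval (X := fun i (x : Fin p → ℝ) => x i) hG i).memLp_two
  rw [covariance_fun_sum_left (fun i => (hL i).const_mul _) (hL k)]
  simp_rw [covariance_const_mul_left, hcov]

lemma indep_lin {p : ℕ} (Sig : Matrix (Fin p) (Fin p) ℝ) (μ : Measure (Fin p → ℝ))
    [IsProbabilityMeasure μ] (hG : HasGaussianLaw (fun x : Fin p → ℝ => x) μ)
    (hcov : ∀ i k, cov[fun x : Fin p → ℝ => x i, fun x => x k; μ] = Sig i k)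
    (u : Fin p → ℝ) {ι : Type} [Finite ι] (r : ι → Fin p)
    (h : ∀ a, ∑ i, u i * Sig i (r a) = 0) :
    IndepFun (fun x : Fin p → ℝ => ∑ i, u i * x i) (fun x a => x (r a)) μ := by
  have := Fintype.ofFinite ι
  let Λ : (Fin p → ℝ) →L[ℝ] ((Unit → ℝ) × (ι → ℝ)) :=
    (ContinuousLinearMap.pi fun _ => ∑ i, u i • ContinuousLinearMap.proj i).prod
      (ContinuousLinearMap.pi fun a => ContinuousLinearMap.proj (r a))
  have h1 : HasGaussianLaw (fun x : Fin p → ℝ => ((fun _ : Unit => ∑ i, u i * x i),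
      (fun a : ι => x (r a)))) μ := by
    refine (hG.map_fun Λ).congr (Filter.Eventually.of_forall fun x => ?_)
    refine Prod.ext ?_ ?_
    · funext t; simp [Λ]
    · funext t; simp [Λ]
  have h2 := HasGaussianLaw.indepFun_of_covariance_eval
    (X := fun (_ : Unit) (x : Fin p → ℝ) => ∑ i, u i * x i)
    (Y := fun (a : ι) (x : Fin p → ℝ) => x (r a)) h1
    (fun _ a => by rw [cov_lin Sig μ hG hcov, h])
  exact h2.comp (φ := fun f : Unit → ℝ => f ()) (ψ := id) (measurable_pi_apply _) measurable_id

lemma condIndep_iff_cov {p : ℕ}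
    (pa : Fin p → Finset (Fin p)) (hpa : ∀ j : Fin p, ∀ i ∈ pa j, j < i)
    (Sig : Matrix (Fin p) (Fin p) ℝ) (μ : Measure (Fin p → ℝ))
    [IsProbabilityMeasure μ] (hG : HasGaussianLaw (fun x : Fin p → ℝ => x) μ)
    (hcov : ∀ i k, cov[fun x : Fin p → ℝ => x i, fun x => x k; μ] = Sig i k)
    (j : Fin p) (u : Fin p → ℝ) (huj : u j = 1) (hu0 : ∀ i, i ≠ j → i ∉ pa j → u i = 0)
    (hu : ∀ k ∈ pa j, ∑ i, u i * Sig i k = 0) :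
    CondIndepFun
          (MeasurableSpace.comap (fun (x : Fin p → ℝ) (a : {i // i ∈ pa j}) => x a.1)
            inferInstance)
          ((measurable_pi_lambda _ fun _ =>
            measurable_pi_apply _ : Measurable
              (fun (x : Fin p → ℝ) (a : {i // i ∈ pa j}) => x a.1)).comap_le)
          (fun x : Fin p → ℝ => x j)
          (fun (x : Fin p → ℝ) (a : {i : Fin p // j < i ∧ i ∉ pa j}) => x a.1) μ
      ↔ ∀ k, j < k → ∑ i, u i * Sig i k = 0 := by
  have hL : ∀ i, HasGaussianLaw (fun x : Fin p → ℝ => x i) μ := fun i =>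
    HasGaussianLaw.eval (X := fun i (x : Fin p → ℝ) => x i) hG i
  have hjpa : j ∉ pa j := fun h => lt_irrefl _ (hpa j j h)
  have hsum : ∀ x : Fin p → ℝ, ∑ i, u i * x i = x j + ∑ a : {i // i ∈ pa j}, u a.1 * x a.1 := by
    intro x
    rw [Finset.sum_coe_sort (pa j) (fun i => u i * x i)]
    have : x j + ∑ i ∈ pa j, u i * x i = ∑ i ∈ insert j (pa j), u i * x i := by
      rw [Finset.sum_insert hjpa, huj, one_mul]
    rw [this]
    symm
    refine Finset.sum_subset (Finset.subset_univ _) fun i _ hi => ?_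
    rw [Finset.mem_insert, not_or] at hi
    rw [hu0 i hi.1 hi.2, zero_mul]
  have key := condIndep_iff_indep μ (fun (x : Fin p → ℝ) (a : {i // i ∈ pa j}) => x a.1)
    (measurable_pi_lambda _ fun _ => measurable_pi_apply _)
    (fun (x : Fin p → ℝ) (a : {i : Fin p // j < i ∧ i ∉ pa j}) => x a.1)
    (measurable_pi_lambda _ fun _ => measurable_pi_apply _)
    (fun x => x j) (measurable_pi_apply j) (fun x => ∑ i, u i * x i) (by fun_prop)
    (fun y => -∑ a, u a.1 * y a) (by fun_prop)
    (fun x => by rw [hsum]; ring)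
    (indep_lin Sig μ hG hcov u (fun a : {i // i ∈ pa j} => a.1) (fun a => hu a.1 a.2))
  refine key.trans ⟨fun h k hk => ?_, fun h => ?_⟩
  · by_cases hkp : k ∈ pa j
    · exact hu k hkp
    · have h1 : IndepFun (fun x : Fin p → ℝ => ∑ i, u i * x i) (fun x => x k) μ :=
        h.comp (φ := id) (ψ := fun q : ({i // i ∈ pa j} → ℝ) ×
          ({i : Fin p // j < i ∧ i ∉ pa j} → ℝ) => q.2 ⟨k, hk, hkp⟩) measurable_id (by fun_prop)
      rw [← cov_lin Sig μ hG hcov]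
      refine h1.covariance_eq_zero ?_ (hL k).memLp_two
      exact memLp_finsetSum _ fun i _ => (hL i).memLp_two.const_mul _
  · have h1 := indep_lin Sig μ hG hcov u (fun a : {k : Fin p // j < k} => a.1)
      (fun a => h a.1 a.2)
    exact h1.comp (φ := id) (ψ := fun y : {k : Fin p // j < k} → ℝ =>
      ((fun a : {i // i ∈ pa j} => y ⟨a.1, hpa j a.1 a.2⟩),
       (fun a : {i : Fin p // j < i ∧ i ∉ pa j} => y ⟨a.1, a.2.1⟩))) measurable_id (by fun_prop)

lemma exists_regression {p : ℕ} (Sig : Matrix (Fin p) (Fin p) ℝ) (hSig : Sig.PosDef)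
    (j : Fin p) (s : Finset (Fin p)) (hj : j ∉ s) :
    ∃ u : Fin p → ℝ, u j = 1 ∧ (∀ i, i ≠ j → i ∉ s → u i = 0) ∧
      ∀ k ∈ s, ∑ i, u i * Sig i k = 0 := by
  let A : Matrix {i // i ∈ s} {i // i ∈ s} ℝ := Sig.submatrix Subtype.val Subtype.val
  have hA : A.PosDef := hSig.submatrix Subtype.val_injective
  have hAu : IsUnit A.det := isUnit_iff_ne_zero.mpr hA.det_pos.ne'
  let b : {i // i ∈ s} → ℝ := (fun k => - Sig j k.1) ᵥ* A⁻¹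
  have hb : b ᵥ* A = fun k => - Sig j k.1 := by
    simp only [b]
    rw [vecMul_vecMul, nonsing_inv_mul _ hAu, vecMul_one]
  refine ⟨fun i => if i = j then 1 else if h : i ∈ s then b ⟨i, h⟩ else 0, by simp, ?_, ?_⟩
  · intro i h1 h2; simp [h1, h2]
  · intro k hk
    have h1 := congrFun hb ⟨k, hk⟩
    simp only [vecMul, dotProduct, A, submatrix_apply] at h1
    rw [← Finset.sum_subset (Finset.subset_univ (insert j s)), Finset.sum_insert hj,
      ← Finset.sum_coe_sort s]
    · have : ∀ a : {i // i ∈ s}, a.1 ≠ j := fun a h => hj (h ▸ a.2)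
      simp only [if_true, one_mul, this, if_false, Subtype.coe_eta, Finset.coe_mem, dite_true]
      rw [h1]; ring
    · intro i _ hi
      rw [Finset.mem_insert, not_or] at hi
      simp [hi.1, hi.2]

/-- For a DAG with edges from larger to smaller vertices, the Gaussian distributions obeying
the directed Markov property with respect to the DAG are exactly those of the form
`N_p(0, (Lᵀ)⁻¹ D L⁻¹)` with `(D,L)` in the Cholesky space `Θ_D`: a Gaussian `N_p(0, Σ)`
(given by its density with precision `Σ⁻¹`) satisfies
`x_j ⟂ x_{{i>j}∖pa_j} | x_{pa_j}` for every `j` if and only if `Sig = (Lᵀ)⁻¹ D L⁻¹` for some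
strictly positive diagonal matrix `D` and some unit lower triangular `L` with `L_ij = 0`
whenever `i ∉ pa_j`. -/
theorem gaussian_markov_equals_cholesky_space {p : ℕ}
    (pa : Fin p → Finset (Fin p)) (hpa : ∀ j : Fin p, ∀ i ∈ pa j, j < i)
    (Sig : Matrix (Fin p) (Fin p) ℝ) (hSig : Sig.PosDef) (hsymm : Sig.IsSymm)
    (μ : Measure (Fin p → ℝ)) [IsProbabilityMeasure μ]
    (hμ : μ = MeasureTheory.volume.withDensity fun x =>
      ENNReal.ofReal ((2 * π) ^ (-(p : ℝ) / 2) * (Sig⁻¹).det ^ ((1 : ℝ) / 2)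
        * Real.exp (-(1 / 2) * (x ⬝ᵥ (Sig⁻¹ *ᵥ x))))) :
    (∀ j : Fin p,
        CondIndepFun
          (MeasurableSpace.comap (fun (x : Fin p → ℝ) (a : {i // i ∈ pa j}) => x a.1)
            inferInstance)
          ((measurable_pi_lambda _ fun _ =>
            measurable_pi_apply _ : Measurable
              (fun (x : Fin p → ℝ) (a : {i // i ∈ pa j}) => x a.1)).comap_le)
          (fun x : Fin p → ℝ => x j)
          (fun (x : Fin p → ℝ) (a : {i : Fin p // j < i ∧ i ∉ pa j}) => x a.1) μ)
      ↔ ∃ D L : Matrix (Fin p) (Fin p) ℝ,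
          D.IsDiag ∧ (∀ i, 0 < D i i) ∧
          (∀ i j : Fin p, i < j → L i j = 0) ∧ (∀ i, L i i = 1) ∧
          (∀ i j : Fin p, i ≠ j → i ∉ pa j → L i j = 0) ∧
          Sig = (L.transpose)⁻¹ * D * L⁻¹ := by
  obtain ⟨hG, hcov⟩ := gaussian_facts Sig hSig _ μ hμ
  have hjpa : ∀ j, j ∉ pa j := fun j h => lt_irrefl _ (hpa j j h)
  have hdetL : ∀ L : Matrix (Fin p) (Fin p) ℝ, (∀ i j : Fin p, i < j → L i j = 0) →
      (∀ i, L i i = 1) → L.det = 1 := by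
    intro L h0 h1
    rw [det_of_lowerTriangular L (fun i j hij => h0 i j hij)]
    simp [h1]
  constructor
  · intro H
    choose u huj hu0 hu using fun j => exists_regression Sig hSig j (pa j) (hjpa j)
    have hz : ∀ j k, j < k → ∑ i, u j i * Sig i k = 0 := fun j =>
      (condIndep_iff_cov pa hpa Sig μ hG hcov j (u j) (huj j) (hu0 j) (hu j)).1 (H j)
    let L : Matrix (Fin p) (Fin p) ℝ := Matrix.of fun i j => u j i
    have hL0 : ∀ i j : Fin p, i < j → L i j = 0 := fun i j hij =>
      hu0 j i hij.ne fun h => lt_asymm hij (hpa j i h)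
    have hL1 : ∀ i, L i i = 1 := huj
    have hLu : IsUnit L.det := by rw [hdetL L hL0 hL1]; exact isUnit_one
    have hLtu : IsUnit L.transpose.det := by rwa [det_transpose]
    have hM : ∀ j k, j < k → (L.transpose * Sig) j k = 0 := fun j k hjk => by
      rw [Matrix.mul_apply]; exact hz j k hjk
    have hlow : ∀ j k, j < k → (L.transpose * Sig * L) j k = 0 := by
      intro j k hjk
      rw [Matrix.mul_apply]
      refine Finset.sum_eq_zero fun i _ => ?_
      by_cases hi : j < i
      · rw [hM j i hi, zero_mul]
      · rw [hL0 i k (lt_of_le_of_lt (not_lt.1 hi) hjk), mul_zero]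
    have hsy : (L.transpose * Sig * L).transpose = L.transpose * Sig * L := by
      rw [transpose_mul, transpose_mul, transpose_transpose, hsymm.eq, Matrix.mul_assoc]
    have hpd : (L.transpose * Sig * L).PosDef := by
      have := hSig.conjTranspose_mul_mul_same (B := L)
        (Matrix.mulVec_injective_of_isUnit ((Matrix.isUnit_iff_isUnit_det L).2 hLu))
      rwa [conjTranspose_eq_transpose_of_trivial] at this
    refine ⟨L.transpose * Sig * L, L, ?_, fun i => hpd.diag_pos, hL0, hL1,
      fun i j hij hi => hu0 j i hij hi, ?_⟩
    · intro j k hjk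
      rcases lt_or_gt_of_ne hjk with h | h
      · exact hlow j k h
      · have := hlow k j h
        rw [← hsy] at this
        exact this
    · rw [Matrix.mul_assoc, mul_nonsing_inv_cancel_right _ _ hLu,
        nonsing_inv_mul_cancel_left _ _ hLtu]
  · rintro ⟨D, L, hD, hDpos, hL0, hL1, hLpa, hS⟩ j
    have hLu : IsUnit L.det := by rw [hdetL L hL0 hL1]; exact isUnit_one
    have hLtu : IsUnit L.transpose.det := by rwa [det_transpose]
    have hinv : ∀ i k, i < k → L⁻¹ i k = 0 := by
      have hb : BlockTriangular L (OrderDual.toDual : Fin p → (Fin p)ᵒᵈ) :=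
        fun i k hik => hL0 i k hik
      have := L.invertibleOfIsUnitDet hLu
      have h2 := blockTriangular_inv_of_blockTriangular hb
      exact fun i k hik => h2 hik
    have hM : L.transpose * Sig = D * L⁻¹ := by
      rw [hS, Matrix.mul_assoc, mul_nonsing_inv_cancel_left _ _ hLtu]
    have hz : ∀ k, j < k → ∑ i, L i j * Sig i k = 0 := by
      intro k hk
      have h1 : (L.transpose * Sig) j k = 0 := by
        rw [hM, Matrix.mul_apply]
        refine Finset.sum_eq_zero fun i _ => ?_
        by_cases hi : j = i
        · subst hi; rw [hinv _ _ hk, mul_zero]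
        · rw [hD hi, zero_mul]
      rw [Matrix.mul_apply] at h1
      exact h1
    exact (condIndep_iff_cov pa hpa Sig μ hG hcov j (fun i => L i j) (hL1 j)
      (fun i h1 h2 => hLpa i j h1 h2) (fun k hk => hz k (hpa j k hk))).2 hz
end

section
/- The DAG-Wishart density π^{Θ_D}_{U,α(D)}(D,L) ∝ exp(−½ tr((L D⁻¹ Lᵀ)U)) ∏_{i=1}^p D_ii^{−α_i(D)/2} on the Cholesky space Θ_D integrates to the normalizing constant z_D(U, α(D)) = ∏_{i=1}^p Γ(α_i(D)/2 − ν_i(D)/2 − 1) · 2^{α_i(D)/2 − 1} · π^{ν_i(D)/2} · det(U_D^{>i})^{α_i(D)/2 − ν_i(D)/2 − 3/2} / det(U_D^{≥i})^{α_i(D)/2 − ν_i(D)/2 − 1}, provided min_i (α_i(D) − ν_i(D)) > 2 and U is positive definite. -/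
open Matrix Real MeasureTheory Finset

/-- The unit lower triangular matrix determined by a parent structure `pa` (edges from larger
to smaller vertices) and free entries `l i : pa i → ℝ` in column `i`. -/
noncomputable def cholFactor {p : ℕ} (pa : Fin p → Finset (Fin p))
    (l : ∀ i : Fin p, {j // j ∈ pa i} → ℝ) : Matrix (Fin p) (Fin p) ℝ :=
  fun j i => if j = i then 1 else if h : j ∈ pa i then l i ⟨j, h⟩ else 0

/-- The submatrix `U_D^{>i} = (U_kj)_{k,j ∈ pa_i(D)}`. -/
noncomputable def subGT {p : ℕ} (pa : Fin p → Finset (Fin p))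
    (U : Matrix (Fin p) (Fin p) ℝ) (i : Fin p) :
    Matrix {j // j ∈ pa i} {j // j ∈ pa i} ℝ :=
  Matrix.of fun a b => U a.1 b.1

/-- The matrix `U_D^{≥i}` with blocks `U_ii`, `(U_ij)_{j∈pa_i}`, `(U_ji)_{j∈pa_i}` and `U_D^{>i}`. -/
noncomputable def subGE {p : ℕ} (pa : Fin p → Finset (Fin p))
    (U : Matrix (Fin p) (Fin p) ℝ) (i : Fin p) :
    Matrix (Unit ⊕ {j // j ∈ pa i}) (Unit ⊕ {j // j ∈ pa i}) ℝ :=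
  Matrix.fromBlocks (Matrix.of fun _ _ => U i i) (Matrix.of fun _ b => U i b.1)
    (Matrix.of fun a _ => U a.1 i) (subGT pa U i)

/-- The normalizing constant `z_D(U, α(D))` of the DAG-Wishart distribution. -/
noncomputable def zDAG {p : ℕ} (pa : Fin p → Finset (Fin p))
    (U : Matrix (Fin p) (Fin p) ℝ) (α : Fin p → ℝ) : ℝ :=
  ∏ i : Fin p,
    Real.Gamma (α i / 2 - ((pa i).card : ℝ) / 2 - 1)
      * (2 : ℝ) ^ (α i / 2 - 1)
      * Real.sqrt π ^ ((pa i).card)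
      * (subGT pa U i).det ^ (α i / 2 - ((pa i).card : ℝ) / 2 - 3 / 2)
      / (subGE pa U i).det ^ (α i / 2 - ((pa i).card : ℝ) / 2 - 1)

/-- The unnormalized DAG-Wishart density
`exp(−½ tr((L D⁻¹ Lᵀ) U)) ∏ᵢ D_ii^{−α_i/2}` on the Cholesky space `Θ_D`. -/
noncomputable def dagWishartKernel {p : ℕ} (pa : Fin p → Finset (Fin p))
    (U : Matrix (Fin p) (Fin p) ℝ) (α : Fin p → ℝ)
    (d : Fin p → ℝ) (l : ∀ i : Fin p, {j // j ∈ pa i} → ℝ) : ℝ :=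
  Real.exp (-(1 / 2) * Matrix.trace
      ((cholFactor pa l * (Matrix.diagonal d)⁻¹ * (cholFactor pa l).transpose) * U))
    * ∏ i : Fin p, (d i) ^ (-(α i) / 2)

lemma dag_gauss {s : Type*} [Fintype s] [DecidableEq s] (A : Matrix s s ℝ) (hA : A.PosDef)
    (b : ℝ) :
    ∫ x : s → ℝ, Real.exp (-b * (x ⬝ᵥ A *ᵥ x))
      = Real.sqrt (π / b) ^ (Fintype.card s) * A.det ^ (-(1 / 2) : ℝ) := by
  obtain ⟨B, hB⟩ : ∃ B : Matrix s s ℝ, A = Bᵀ * B := by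
    open scoped MatrixOrder Matrix.Norms.L2Operator in
    obtain ⟨B, hB⟩ := CStarAlgebra.nonneg_iff_eq_star_mul_self.mp hA.posSemidef.nonneg
    exact ⟨B, by rw [hB, star_eq_conjTranspose, conjTranspose_eq_transpose_of_trivial]⟩
  have hdet : A.det = |B.det| ^ 2 := by
    rw [hB, det_mul, det_transpose, sq_abs, sq]
  have hpos := hA.det_pos
  have hB0 : B.det ≠ 0 := by
    intro h; rw [hdet, h] at hpos; simp at hpos
  have h1 : ∀ x : s → ℝ, Real.exp (-b * (x ⬝ᵥ A *ᵥ x))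
      = (fun y : s → ℝ => ∏ k, Real.exp (-b * (y k) ^ 2)) (Matrix.toLin' B x) := by
    intro x
    have : x ⬝ᵥ A *ᵥ x = ∑ k, (B *ᵥ x) k ^ 2 := by
      rw [hB, ← mulVec_mulVec, dotProduct_mulVec, vecMul_transpose]
      simp [dotProduct, sq]
    simp only [toLin'_apply]
    rw [this, ← Real.exp_sum, Finset.mul_sum]
  simp_rw [h1]
  have hc : Continuous (fun y : s → ℝ => ∏ k, Real.exp (-b * (y k) ^ 2)) := by fun_prop
  have hm : Measurable (Matrix.toLin' B) :=
    (LinearMap.continuous_of_finiteDimensional (Matrix.toLin' B)).measurable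
  rw [← integral_map (φ := Matrix.toLin' B) hm.aemeasurable hc.aestronglyMeasurable,
    Real.map_matrix_volume_pi_eq_smul_volume_pi hB0, integral_smul_measure,
    integral_fintype_prod_volume_eq_pow (fun y : ℝ => Real.exp (-b * y ^ 2)), integral_gaussian,
    ENNReal.toReal_ofReal (abs_nonneg _), hdet, ← Real.rpow_natCast |B.det| 2,
    ← Real.rpow_mul (abs_nonneg _)]
  norm_num
  rw [Real.rpow_neg_one, mul_comm]

lemma dag_single {s : Type*} [Fintype s] [DecidableEq s] (A : Matrix s s ℝ) (hA : A.PosDef)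
    (v : s → ℝ) (c : ℝ) (hc : 0 < c) (a : ℝ) (ha : (Fintype.card s : ℝ) / 2 < a) :
    ∫ l : s → ℝ, ∫ d in Set.Ioi (0 : ℝ),
        Real.exp (-(1 / 2) * (d⁻¹ * (c + (l + v) ⬝ᵥ A *ᵥ (l + v)))) * d ^ (-(a + 1))
      = Real.Gamma (a - (Fintype.card s : ℝ) / 2) * 2 ^ a * Real.sqrt π ^ (Fintype.card s)
        * A.det ^ (-(1 / 2) : ℝ) * c ^ (-(a - (Fintype.card s : ℝ) / 2)) := by
  set n := Fintype.card s with hn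
  have hdet := hA.det_pos
  -- change of variables
  have h1 : ∀ l : s → ℝ, ∫ d in Set.Ioi (0 : ℝ),
        Real.exp (-(1 / 2) * (d⁻¹ * (c + (l + v) ⬝ᵥ A *ᵥ (l + v)))) * d ^ (-(a + 1))
      = ∫ t in Set.Ioi (0 : ℝ), (t ^ (a - 1) * Real.exp (-(c / 2 * t))) *
          Real.exp (-(t / 2) * ((l + v) ⬝ᵥ A *ᵥ (l + v))) := by
    intro l
    rw [← integral_comp_rpow_Ioi _ (p := -1) (by norm_num)]
    refine setIntegral_congr_fun measurableSet_Ioi fun t ht => ?_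
    have ht' : 0 < t := ht
    simp only [smul_eq_mul]
    rw [← Real.rpow_mul ht'.le, Real.rpow_neg_one, inv_inv, mul_assoc (t ^ (a - 1)), ← Real.exp_add]
    have e1 : t ^ (a - 1) = t ^ ((-1 : ℝ) - 1) * t ^ (-1 * -(a + 1)) := by
      rw [← Real.rpow_add ht']; congr 1; ring
    rw [e1]
    have e2 : |(-1 : ℝ)| = 1 := by norm_num
    rw [e2]
    have e3 : -(1 / 2) * (t * (c + (l + v) ⬝ᵥ A *ᵥ (l + v))) =
       (-(c / 2 * t) + -(t / 2) * (l + v) ⬝ᵥ A *ᵥ (l + v)) := by ring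
    rw [e3]; ring
  simp_rw [h1]
  have hg : ∀ t : ℝ, ∫ l : s → ℝ, Real.exp (-(t / 2) * ((l + v) ⬝ᵥ A *ᵥ (l + v)))
      = Real.sqrt (π / (t / 2)) ^ n * A.det ^ (-(1 / 2) : ℝ) := by
    intro t
    rw [integral_add_right_eq_self (fun l : s → ℝ => Real.exp (-(t / 2) * (l ⬝ᵥ A *ᵥ l))) v]
    exact dag_gauss A hA _
  have hin : ∀ t : ℝ, ∫ l : s → ℝ, (t ^ (a - 1) * Real.exp (-(c / 2 * t))) *
          Real.exp (-(t / 2) * ((l + v) ⬝ᵥ A *ᵥ (l + v)))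
      = (t ^ (a - 1) * Real.exp (-(c / 2 * t))) *
        (Real.sqrt (π / (t / 2)) ^ n * A.det ^ (-(1 / 2) : ℝ)) := by
    intro t
    rw [integral_const_mul, hg]
  have hout : ∀ t ∈ Set.Ioi (0 : ℝ), (t ^ (a - 1) * Real.exp (-(c / 2 * t))) *
        (Real.sqrt (π / (t / 2)) ^ n * A.det ^ (-(1 / 2) : ℝ))
      = (Real.sqrt π ^ n * 2 ^ ((n : ℝ) / 2) * A.det ^ (-(1 / 2) : ℝ)) *
        (t ^ ((a - (n : ℝ) / 2) - 1) * Real.exp (-(c / 2 * t))) := by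
    intro t ht
    have ht' : 0 < t := ht
    have e1 : Real.sqrt (π / (t / 2)) ^ n
        = Real.sqrt π ^ n * 2 ^ ((n : ℝ) / 2) * t ^ (-((n : ℝ) / 2)) := by
      have : π / (t / 2) = π * 2 * t⁻¹ := by field_simp
      rw [this, Real.sqrt_mul (by positivity), Real.sqrt_mul (by positivity), mul_pow, mul_pow]
      congr 1
      · congr 1
        rw [Real.sqrt_eq_rpow, ← Real.rpow_natCast, ← Real.rpow_mul (by norm_num)]
        congr 1; ring
      · rw [Real.sqrt_eq_rpow, ← Real.rpow_natCast, ← Real.rpow_mul (by positivity),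
          Real.inv_rpow ht'.le, Real.rpow_neg ht'.le]
        congr 2; ring
    have e2 : t ^ ((a - (n : ℝ) / 2) - 1) = t ^ (a - 1) * t ^ (-((n : ℝ) / 2)) := by
      rw [← Real.rpow_add ht']; congr 1; ring
    rw [e1, e2]; ring
  have ha' : 0 < a - (n : ℝ) / 2 := by linarith
  have hgam := Real.integral_rpow_mul_exp_neg_mul_Ioi ha' (half_pos hc)
  have hfin : ∫ t in Set.Ioi (0 : ℝ), (t ^ (a - 1) * Real.exp (-(c / 2 * t))) *
        (Real.sqrt (π / (t / 2)) ^ n * A.det ^ (-(1 / 2) : ℝ)) =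
      (Real.sqrt π ^ n * 2 ^ ((n : ℝ) / 2) * A.det ^ (-(1 / 2) : ℝ)) *
        ((1 / (c / 2)) ^ (a - (n : ℝ) / 2) * Real.Gamma (a - (n : ℝ) / 2)) := by
    rw [setIntegral_congr_fun measurableSet_Ioi hout, integral_const_mul, hgam]
  have hG := Real.Gamma_pos_of_pos ha'
  have hint : Integrable (Function.uncurry fun (l : s → ℝ) (t : ℝ) =>
      (t ^ (a - 1) * Real.exp (-(c / 2 * t))) *
          Real.exp (-(t / 2) * ((l + v) ⬝ᵥ A *ᵥ (l + v))))
      ((volume : Measure (s → ℝ)).prod (volume.restrict (Set.Ioi (0 : ℝ)))) := by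
    rw [integrable_prod_iff']
    · constructor
      · filter_upwards [ae_restrict_mem measurableSet_Ioi] with t ht
        have ht' : 0 < t := ht
        apply Integrable.of_integral_ne_zero
        simp only [Function.uncurry]
        rw [hin]
        positivity
      · have : (fun t : ℝ => ∫ l : s → ℝ, ‖(t ^ (a - 1) * Real.exp (-(c / 2 * t))) *
            Real.exp (-(t / 2) * ((l + v) ⬝ᵥ A *ᵥ (l + v)))‖)
            =ᵐ[volume.restrict (Set.Ioi (0 : ℝ))]
            fun t => (t ^ (a - 1) * Real.exp (-(c / 2 * t))) *
              (Real.sqrt (π / (t / 2)) ^ n * A.det ^ (-(1 / 2) : ℝ)) := by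
          filter_upwards [ae_restrict_mem measurableSet_Ioi] with t ht
          have ht' : 0 < t := ht
          rw [← hin]
          congr 1
          funext l
          exact Real.norm_of_nonneg (by positivity)
        refine Integrable.congr ?_ this.symm
        apply Integrable.of_integral_ne_zero
        rw [hfin]
        positivity
    · apply Measurable.aestronglyMeasurable
      simp only [dotProduct, mulVec]
      fun_prop
  rw [integral_integral_swap hint]
  simp_rw [hin]
  rw [hfin]
  have e4 : (2 : ℝ) ^ a = 2 ^ ((n : ℝ) / 2) * 2 ^ (a - (n : ℝ) / 2) := by
    rw [← Real.rpow_add (by norm_num)]; congr 1; ring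
  have e5 : (1 / (c / 2)) ^ (a - (n : ℝ) / 2)
      = 2 ^ (a - (n : ℝ) / 2) * c ^ (-(a - (n : ℝ) / 2)) := by
    rw [one_div_div, Real.div_rpow (by norm_num) hc.le, Real.rpow_neg hc.le, div_eq_mul_inv]
  rw [e4, e5]; ring

lemma dag_block {s : Type*} [Fintype s] [DecidableEq s] (A : Matrix s s ℝ) (hA : A.PosDef)
    (u : s → ℝ) (w : ℝ)
    (hG : (Matrix.fromBlocks (Matrix.of fun (_ _ : Unit) => w) (Matrix.of fun _ b => u b)
      (Matrix.of fun a _ => u a) A).PosDef) (α : ℝ) (hα : 2 < α - (Fintype.card s : ℝ)) :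
    ∫ l : s → ℝ, ∫ d in Set.Ioi (0 : ℝ),
        Real.exp (-(1 / 2) * (d⁻¹ * (w + 2 * (l ⬝ᵥ u) + l ⬝ᵥ A *ᵥ l))) * d ^ (-α / 2)
      = Real.Gamma (α / 2 - (Fintype.card s : ℝ) / 2 - 1)
      * (2 : ℝ) ^ (α / 2 - 1)
      * Real.sqrt π ^ (Fintype.card s)
      * A.det ^ (α / 2 - (Fintype.card s : ℝ) / 2 - 3 / 2)
      / (Matrix.fromBlocks (Matrix.of fun (_ _ : Unit) => w) (Matrix.of fun _ b => u b)
      (Matrix.of fun a _ => u a) A).det ^ (α / 2 - (Fintype.card s : ℝ) / 2 - 1) := by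
  have hdet := hA.det_pos
  have hGdet := hG.det_pos
  have hunit : IsUnit A.det := hdet.ne'.isUnit
  let _ : Invertible A := Matrix.invertibleOfIsUnitDet A hunit
  set G := (Matrix.fromBlocks (Matrix.of fun (_ _ : Unit) => w) (Matrix.of fun _ b => u b)
      (Matrix.of fun a _ => u a) A) with hGdef
  set v := A⁻¹ *ᵥ u with hv
  have hAv : A *ᵥ v = u := by rw [hv, mulVec_mulVec, Matrix.mul_nonsing_inv _ hunit, one_mulVec]
  have hAt : Aᵀ = A := by
    have := hA.1; rwa [IsHermitian, conjTranspose_eq_transpose_of_trivial] at this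
  have hc : G.det = A.det * (w - u ⬝ᵥ v) := by
    rw [hGdef, det_fromBlocks₂₂, invOf_eq_nonsing_inv, det_unique (n := Unit)]
    congr 1
    simp only [Matrix.sub_apply, of_apply]
    congr 1
    rw [hv, dotProduct_mulVec]
    simp [Matrix.mul_apply, vecMul, dotProduct]
  have hcpos : 0 < w - u ⬝ᵥ v := by
    rw [hc] at hGdet; exact (pos_iff_pos_of_mul_pos hGdet).1 hdet
  have hq : ∀ l : s → ℝ, w + 2 * (l ⬝ᵥ u) + l ⬝ᵥ A *ᵥ l
      = (w - u ⬝ᵥ v) + (l + v) ⬝ᵥ A *ᵥ (l + v) := by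
    intro l
    have : v ⬝ᵥ A *ᵥ l = u ⬝ᵥ l := by
      rw [dotProduct_mulVec, ← mulVec_transpose, hAt, hAv]
    rw [mulVec_add, hAv, add_dotProduct, dotProduct_add, dotProduct_add, this,
      dotProduct_comm u l, dotProduct_comm v u]
    ring
  simp_rw [hq]
  have e : -α / 2 = -((α / 2 - 1) + 1) := by ring
  rw [e, dag_single A hA v _ hcpos (α / 2 - 1) (by linarith), hc,
    Real.mul_rpow hdet.le hcpos.le]
  have e1 : α / 2 - 1 - (Fintype.card s : ℝ) / 2 = α / 2 - (Fintype.card s : ℝ) / 2 - 1 := by ring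
  rw [e1, Real.rpow_neg hcpos.le]
  have e2 : A.det ^ (α / 2 - (Fintype.card s : ℝ) / 2 - 3 / 2)
     = A.det ^ (-(1 / 2) : ℝ) * A.det ^ (α / 2 - (Fintype.card s : ℝ) / 2 - 1) := by
    rw [← Real.rpow_add hdet]; congr 1; ring
  rw [e2]
  have : 0 < A.det ^ (α / 2 - (Fintype.card s : ℝ) / 2 - 1) := by positivity
  have : 0 < (w - u ⬝ᵥ v) ^ (α / 2 - (Fintype.card s : ℝ) / 2 - 1) := by positivity
  field_simp

lemma dag_sum {p : ℕ} (pa : Fin p → Finset (Fin p)) (hpa : ∀ i : Fin p, ∀ j ∈ pa i, i < j)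
    (l : ∀ i : Fin p, {j // j ∈ pa i} → ℝ) (i : Fin p) (f : Fin p → ℝ) :
    ∑ j, cholFactor pa l j i * f j = f i + ∑ j : {j // j ∈ pa i}, l i j * f j.1 := by
  have hi : i ∉ pa i := fun h => lt_irrefl _ (hpa i i h)
  have h1 : ∀ j, cholFactor pa l j i * f j
      = (if j = i then f j else 0) + (if h : j ∈ pa i then l i ⟨j, h⟩ * f j else 0) := by
    intro j
    unfold cholFactor
    by_cases hj : j = i
    · subst hj; simp [hi]
    · by_cases h : j ∈ pa i <;> simp [hj, h]
  simp_rw [h1]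
  rw [Finset.sum_add_distrib]
  congr 1
  · simp
  · rw [← Finset.sum_subset (Finset.subset_univ (pa i)) (fun x _ hx => by simp [hx]),
      ← Finset.sum_coe_sort]
    exact Finset.sum_congr rfl fun x _ => by simp

lemma dag_trace {p : ℕ} (pa : Fin p → Finset (Fin p)) (hpa : ∀ i : Fin p, ∀ j ∈ pa i, i < j)
    (U : Matrix (Fin p) (Fin p) ℝ) (hU : U.PosDef)
    (d : Fin p → ℝ) (hd : ∀ i, 0 < d i) (l : ∀ i : Fin p, {j // j ∈ pa i} → ℝ) :
    Matrix.trace ((cholFactor pa l * (Matrix.diagonal d)⁻¹ * (cholFactor pa l).transpose) * U)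
      = ∑ i, (d i)⁻¹ * (U i i + 2 * (l i ⬝ᵥ fun j => U i j.1) + l i ⬝ᵥ subGT pa U i *ᵥ l i) := by
  have hUt : ∀ j k, U j k = U k j := fun j k => by
    have := hU.1.apply j k; simpa using this.symm
  have hinv : (Matrix.diagonal d)⁻¹ = Matrix.diagonal (fun i => (d i)⁻¹) := by
    apply Matrix.inv_eq_right_inv
    rw [diagonal_mul_diagonal, ← diagonal_one]
    congr 1; funext i; exact mul_inv_cancel₀ (hd i).ne'
  rw [hinv]
  have h1 : Matrix.trace ((cholFactor pa l * Matrix.diagonal (fun i => (d i)⁻¹)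
      * (cholFactor pa l).transpose) * U) = ∑ i, (d i)⁻¹ *
        ∑ j, cholFactor pa l j i * ∑ k, cholFactor pa l k i * U k j := by
    rw [Matrix.trace]
    simp only [Matrix.diag]
    simp_rw [Matrix.mul_apply (N := U), Matrix.mul_apply (N := (cholFactor pa l)ᵀ),
      Matrix.mul_diagonal, transpose_apply]
    simp only [
      Finset.mul_sum, Finset.sum_mul]
    rw [Finset.sum_congr rfl (fun j _ => Finset.sum_comm), Finset.sum_comm]
    refine Finset.sum_congr rfl fun i _ => Finset.sum_congr rfl fun j _ =>
      Finset.sum_congr rfl fun k _ => by ring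
  rw [h1]
  refine Finset.sum_congr rfl fun i _ => ?_
  congr 1
  simp_rw [dag_sum pa hpa]
  simp only [mul_add, Finset.sum_add_distrib, dotProduct, mulVec, subGT, of_apply]
  have e1 : ∀ j : {j // j ∈ pa i}, U j.1 i = U i j.1 := fun j => hUt _ _
  have e2 : ∑ x : {j // j ∈ pa i}, l i x * ∑ y : {j // j ∈ pa i}, l i y * U y.1 x.1
      = ∑ x : {j // j ∈ pa i}, l i x * ∑ y : {j // j ∈ pa i}, U x.1 y.1 * l i y :=
    Finset.sum_congr rfl fun x _ => by
      congr 1; exact Finset.sum_congr rfl fun y _ => by rw [hUt y.1 x.1, mul_comm]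
  rw [e2]
  simp_rw [e1]
  ring

/-- The DAG-Wishart density integrates over the Cholesky space to the normalizing constant
`z_D(U, α(D))`, provided `min_i (α_i − ν_i) > 2` and `U` is positive definite. -/
theorem dagWishart_normalizing_constant {p : ℕ}
    (pa : Fin p → Finset (Fin p)) (hpa : ∀ i : Fin p, ∀ j ∈ pa i, i < j)
    (U : Matrix (Fin p) (Fin p) ℝ) (hU : U.PosDef)
    (α : Fin p → ℝ) (hα : ∀ i, 2 < α i - ((pa i).card : ℝ)) :
    (∫ l : ∀ i : Fin p, {j // j ∈ pa i} → ℝ,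
        ∫ d in {d : Fin p → ℝ | ∀ i, 0 < d i}, dagWishartKernel pa U α d l)
      = zDAG pa U α := by
  have hset : {d : Fin p → ℝ | ∀ i, 0 < d i} = Set.univ.pi fun _ => Set.Ioi (0 : ℝ) := by
    ext d; simp
  have hms : MeasurableSet {d : Fin p → ℝ | ∀ i, 0 < d i} := by
    rw [hset]; exact MeasurableSet.univ_pi fun _ => measurableSet_Ioi
  let F : ∀ i : Fin p, ({j // j ∈ pa i} → ℝ) → ℝ → ℝ := fun i x t =>
    Real.exp (-(1 / 2) * (t⁻¹ * (U i i + 2 * (x ⬝ᵥ fun j => U i j.1)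
      + x ⬝ᵥ subGT pa U i *ᵥ x))) * t ^ (-(α i) / 2)
  have hinner : ∀ l : ∀ i : Fin p, {j // j ∈ pa i} → ℝ,
      ∫ d in {d : Fin p → ℝ | ∀ i, 0 < d i}, dagWishartKernel pa U α d l
        = ∏ i, ∫ t in Set.Ioi (0 : ℝ), F i (l i) t := by
    intro l
    have h1 : ∀ d ∈ {d : Fin p → ℝ | ∀ i, 0 < d i},
        dagWishartKernel pa U α d l = ∏ i, F i (l i) (d i) := by
      intro d hd
      unfold dagWishartKernel
      rw [dag_trace pa hpa U hU d hd l, Finset.mul_sum, Real.exp_sum, ← Finset.prod_mul_distrib]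
    rw [setIntegral_congr_fun hms h1, hset, volume_pi, Measure.restrict_pi_pi]
    exact integral_fintype_prod_eq_prod (fun i t => F i (l i) t)
  simp_rw [hinner]
  rw [integral_fintype_prod_volume_eq_prod (fun i x => ∫ t in Set.Ioi (0 : ℝ), F i x t)]
  unfold zDAG
  refine Finset.prod_congr rfl fun i _ => ?_
  have hi : i ∉ pa i := fun h => lt_irrefl _ (hpa i i h)
  have hGE0 : subGE pa U i = U.submatrix (Sum.elim (fun _ : Unit => i) (fun j : {j // j ∈ pa i} => j.1))
      (Sum.elim (fun _ : Unit => i) (fun j : {j // j ∈ pa i} => j.1)) := by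
    ext a b; rcases a with a | a <;> rcases b with b | b <;> rfl
  have hGE : (subGE pa U i).PosDef := by
    rw [hGE0]
    apply hU.submatrix
    apply Function.Injective.sumElim
    · intro a b _; rfl
    · exact Subtype.val_injective
    · rintro a ⟨b, hb⟩ rfl; exact hi hb
  have hGT : (subGT pa U i).PosDef := hU.submatrix Subtype.val_injective
  have hGE1 : subGE pa U i = Matrix.fromBlocks (Matrix.of fun (_ _ : Unit) => U i i)
      (Matrix.of fun _ b => (fun j : {j // j ∈ pa i} => U i j.1) b)
      (Matrix.of fun a _ => (fun j : {j // j ∈ pa i} => U i j.1) a) (subGT pa U i) := by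
    unfold subGE
    congr 1
    ext a b
    have := hU.1.apply i a.1
    simpa using this
  rw [hGE1] at hGE ⊢
  have hcard : Fintype.card {j // j ∈ pa i} = (pa i).card := Fintype.card_coe _
  have := dag_block (subGT pa U i) hGT (fun j => U i j.1) (U i i) hGE (α i)
    (by rw [hcard]; exact hα i)
  rw [hcard] at this
  exact this
end
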